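/- There exists a constant C > 0 such that for all x, y in [0,1]² \ E there is a rectifiable curve γ joining x and y with Euclidean length ℓ(γ) ≤ C |x − y| whose image is disjoint from E. -/

import Mathlib

open MeasureTheory Metric Filter Topology
open scoped NNReal ENNReal

noncomputable section

/-- The plane with the Euclidean distance. -/
abbrev E2 := EuclideanSpace ℝ (Fin 2)

/-- Length of the level-`n` intervals of the Cantor construction: at each step the open
middle interval of length `(1/10)^(n+1)` is removed and two closed intervals of equal
length remain. -/
def clen : ℕ → ℝ
  | 0 => 1
  | n + 1 => (clen n - (1 / 10) ^ (n + 1)) / 2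

/-- Left endpoint of the interval `I_w`; words are written with the innermost (deepest)
digit first, `false` = left child, `true` = right child. -/
def cleft : List Bool → ℝ
  | [] => 0
  | b :: w => cleft w + if b then clen w.length - clen (w.length + 1) else 0

/-- The interval `I_w` of the Cantor construction. -/
def cInt (w : List Bool) : Set ℝ := Set.Icc (cleft w) (cleft w + clen w.length)

/-- The fat Cantor set `F`. -/
def cantorF : Set ℝ := ⋂ n : ℕ, ⋃ w ∈ {w : List Bool | w.length = n}, cInt w

/-- The planar Cantor set `E = F × F`. -/
def cantorE : Set E2 := {z | z 0 ∈ cantorF ∧ z 1 ∈ cantorF}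

/-- The closed unit square `[0,1]²`. -/
def unitSq : Set E2 := {z | z 0 ∈ Set.Icc (0 : ℝ) 1 ∧ z 1 ∈ Set.Icc (0 : ℝ) 1}

theorem pow_le_clen (n : ℕ) : (1 / 10 : ℝ) ^ n ≤ clen n := by
  induction n with
  | zero => simp [clen]
  | succ n ih =>
    have : (0 : ℝ) < (1 / 10) ^ n := by positivity
    rw [clen, pow_succ]
    linarith

theorem clen_pos (n : ℕ) : 0 < clen n :=
  lt_of_lt_of_le (by positivity) (pow_le_clen n)

theorem two_mul_clen_succ_lt (n : ℕ) : 2 * clen (n + 1) < clen n := by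
  have : (0 : ℝ) < (1 / 10) ^ (n + 1) := by positivity
  rw [clen]
  linarith

theorem clen_le_half_pow (n : ℕ) : clen n ≤ (1 / 2) ^ n := by
  induction n with
  | zero => simp [clen]
  | succ n ih =>
    have := two_mul_clen_succ_lt n
    rw [pow_succ]
    linarith

theorem cInt_cons_subset (b : Bool) (w : List Bool) : cInt (b :: w) ⊆ cInt w := by
  have h := two_mul_clen_succ_lt w.length
  have h' := clen_pos (w.length + 1)
  apply Set.Icc_subset_Icc <;> cases b <;> simp [cleft] <;> linarith

theorem eq_of_mem_cInt {t : ℝ} : ∀ {v w : List Bool}, v.length = w.length →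
    t ∈ cInt v → t ∈ cInt w → v = w
  | [], [], _, _, _ => rfl
  | b :: v, c :: w, hl, hv, hw => by
    obtain rfl := eq_of_mem_cInt (by simpa using hl) (cInt_cons_subset b v hv)
      (cInt_cons_subset c w hw)
    have h := two_mul_clen_succ_lt v.length
    obtain ⟨hv₁, hv₂⟩ := hv
    obtain ⟨hw₁, hw₂⟩ := hw
    cases b <;> cases c <;> simp [cleft] at * <;> linarith

theorem midpoint_cInt_notMem_cantorF (w : List Bool) :
    cleft w + clen w.length / 2 ∉ cantorF := by
  intro hm
  obtain ⟨v, hv, hmv⟩ := Set.mem_iUnion₂.1 (Set.mem_iInter.1 hm (w.length + 1))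
  obtain _ | ⟨b, v⟩ := v
  · simp at hv
  have hpos := clen_pos w.length
  obtain rfl : v = w := eq_of_mem_cInt (by simpa using hv) (cInt_cons_subset b v hmv)
    ⟨by linarith, by linarith⟩
  have h := two_mul_clen_succ_lt v.length
  obtain ⟨h₁, h₂⟩ := hmv
  cases b <;> simp [cleft] at h₁ h₂ <;> linarith

theorem exists_notMem_cantorF_abs_sub_le (t : ℝ) {ε : ℝ} (hε : 0 < ε) :
    ∃ h ∉ cantorF, |t - h| ≤ ε := by
  by_cases ht : t ∈ cantorF
  · obtain ⟨n, hn⟩ := exists_pow_lt_of_lt_one hε (by norm_num : (1 / 2 : ℝ) < 1)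
    obtain ⟨w, rfl, hw₁, hw₂⟩ := Set.mem_iUnion₂.1 (Set.mem_iInter.1 ht n)
    have := clen_le_half_pow w.length
    have := clen_pos w.length
    exact ⟨_, midpoint_cInt_notMem_cantorF w, abs_le.2 ⟨by linarith, by linarith⟩⟩
  · exact ⟨t, ht, by simpa using hε.le⟩

/-- A curve of controlled variation on `[0,1]` tracing three consecutive segments. -/
theorem exists_curve_three_segments {V : Type*} [NormedAddCommGroup V] [NormedSpace ℝ V]
    (p q r s : V) :
    ∃ γ : ℝ → V, ContinuousOn γ (Set.Icc 0 1) ∧ γ 0 = p ∧ γ 1 = s ∧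
      eVariationOn γ (Set.Icc 0 1) ≤ ENNReal.ofReal (3 * (dist p q + dist q r + dist r s)) ∧
      ∀ t ∈ Set.Icc (0 : ℝ) 1, γ t ∈ segment ℝ p q ∪ segment ℝ q r ∪ segment ℝ r s := by
  let c : ℝ → ℝ := fun t => max 0 (min 1 t)
  have hc : ∀ a b, |c a - c b| ≤ |a - b| := fun a b =>
    (abs_max_sub_max_le_max 0 (min 1 a) 0 (min 1 b)).trans <| by
      simpa using abs_min_sub_min_le_max 1 a 1 b
  have hc₀ : ∀ t ≤ 0, c t = 0 := fun t ht => max_eq_left ((min_le_right _ _).trans ht)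
  have hc₁ : ∀ t, 1 ≤ t → c t = 1 := fun t ht => by simp [c, ht]
  have hcI : ∀ t, c t ∈ Set.Icc (0 : ℝ) 1 := fun t => ⟨le_max_left _ _, by simp [c]⟩
  let γ : ℝ → V := fun t =>
    p + c (3 * t) • (q - p) + c (3 * t - 1) • (r - q) + c (3 * t - 2) • (s - r)
  have hterm : ∀ (a b k : ℝ) (v : V),
      ‖(c (3 * a - k) - c (3 * b - k)) • v‖ ≤ 3 * |a - b| * ‖v‖ := fun a b k v => by
    rw [norm_smul, Real.norm_eq_abs]
    refine mul_le_mul_of_nonneg_right ((hc _ _).trans_eq ?_) (norm_nonneg v)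
    rw [show 3 * a - k - (3 * b - k) = 3 * (a - b) by ring, abs_mul, abs_of_pos three_pos]
  have hL : LipschitzWith (3 * (dist p q + dist q r + dist r s)).toNNReal γ := by
    refine LipschitzWith.of_dist_le_mul fun a b => ?_
    rw [Real.coe_toNNReal _ (by positivity), dist_eq_norm, Real.dist_eq]
    have hsub : γ a - γ b = (c (3 * a - 0) - c (3 * b - 0)) • (q - p)
        + (c (3 * a - 1) - c (3 * b - 1)) • (r - q)
        + (c (3 * a - 2) - c (3 * b - 2)) • (s - r) := by
      simp only [γ, sub_zero]
      module
    rw [hsub, dist_comm p q, dist_comm q r, dist_comm r s, dist_eq_norm, dist_eq_norm,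
      dist_eq_norm]
    refine norm_add₃_le.trans ?_
    linarith [hterm a b 0 (q - p), hterm a b 1 (r - q), hterm a b 2 (s - r)]
  refine ⟨γ, hL.continuous.continuousOn, ?_, ?_, ?_, fun t _ => ?_⟩
  · simp only [γ]
    rw [hc₀ _ (by norm_num), hc₀ _ (by norm_num), hc₀ _ (by norm_num)]
    simp
  · simp only [γ]
    rw [hc₁ _ (by norm_num), hc₁ _ (by norm_num), hc₁ _ (by norm_num)]
    module
  · have hid : eVariationOn (id : ℝ → ℝ) (Set.Icc 0 1) ≤ 1 := by simp
    calc eVariationOn γ (Set.Icc 0 1) = eVariationOn (γ ∘ id) (Set.Icc 0 1) := rfl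
      _ ≤ _ := hL.lipschitzOnWith.comp_eVariationOn_le (Set.mapsTo_univ _ _)
      _ ≤ _ := mul_le_of_le_one_right' hid
  · simp only [segment_eq_image', γ]
    rcases le_total (3 * t) 1 with h | h
    · refine Or.inl (Or.inl ⟨c (3 * t), hcI _, ?_⟩)
      rw [hc₀ (3 * t - 1) (by linarith), hc₀ (3 * t - 2) (by linarith)]
      module
    rcases le_total (3 * t) 2 with h' | h'
    · refine Or.inl (Or.inr ⟨c (3 * t - 1), hcI _, ?_⟩)
      rw [hc₁ (3 * t) h, hc₀ (3 * t - 2) (by linarith)]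
      module
    · refine Or.inr ⟨c (3 * t - 2), hcI _, ?_⟩
      rw [hc₁ (3 * t) h, hc₁ (3 * t - 1) (by linarith)]
      module

theorem notMem_cantorE_of_apply {z : E2} {i : Fin 2} (h : z i ∉ cantorF) : z ∉ cantorE := by
  rintro ⟨h₀, h₁⟩
  fin_cases i
  exacts [h h₀, h h₁]

theorem notMem_cantorE_of_mem_segment {p q z : E2} {i : Fin 2} (hpq : p i = q i)
    (hp : p i ∉ cantorF) (hz : z ∈ segment ℝ p q) : z ∉ cantorE := by
  apply notMem_cantorE_of_apply (i := i)
  rw [segment_eq_image'] at hz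
  obtain ⟨θ, -, rfl⟩ := hz
  simpa [hpq] using hp

theorem dist_eq_abs_of_apply_eq {p q : E2} {i j : Fin 2} (hij : i ≠ j) (h : p i = q i) :
    dist p q = |p j - q j| := by
  rw [EuclideanSpace.dist_eq, Fin.sum_univ_two]
  fin_cases i <;> fin_cases j <;> simp_all [Real.dist_eq, Real.sqrt_sq_eq_abs]

theorem abs_apply_sub_le_dist (p q : E2) (i : Fin 2) : |p i - q i| ≤ dist p q := by
  rw [dist_eq_norm]
  exact PiLp.norm_apply_le (p - q) i

theorem exists_coords_eq {i j : Fin 2} (hij : i ≠ j) (a b : ℝ) :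
    ∃ z : E2, z i = a ∧ z j = b :=
  ⟨WithLp.toLp 2 (Function.update (fun _ => b) i a), by simp, by simp [hij.symm]⟩

/-- Two points are joined by running along a line `z j = h` that misses `F`. -/
theorem exists_curve_along_line {i j : Fin 2} (hij : i ≠ j) {x y : E2} {h : ℝ}
    (hx : x i ∉ cantorF) (hh : h ∉ cantorF) (hy : y i ∉ cantorF ∨ h = y j)
    (hd : |x j - h| ≤ dist x y) :
    ∃ γ : ℝ → E2, ContinuousOn γ (Set.Icc 0 1) ∧ γ 0 = x ∧ γ 1 = y ∧
      eVariationOn γ (Set.Icc 0 1) ≤ ENNReal.ofReal (12 * dist x y) ∧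
      ∀ t ∈ Set.Icc (0 : ℝ) 1, γ t ∉ cantorE := by
  obtain ⟨q, hqi, hqj⟩ := exists_coords_eq hij (x i) h
  obtain ⟨r, hri, hrj⟩ := exists_coords_eq hij (y i) h
  obtain ⟨γ, hγ, h0, h1, hvar, hmem⟩ := exists_curve_three_segments x q r y
  refine ⟨γ, hγ, h0, h1, hvar.trans (ENNReal.ofReal_le_ofReal ?_), fun t ht => ?_⟩
  · rw [dist_eq_abs_of_apply_eq hij hqi.symm, dist_eq_abs_of_apply_eq hij.symm (hqj.trans hrj.symm),
      dist_eq_abs_of_apply_eq hij hri, hqi, hqj, hri, hrj]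
    have := abs_apply_sub_le_dist x y i
    have := abs_apply_sub_le_dist x y j
    have := abs_sub_le h (x j) (y j)
    rw [abs_sub_comm h (x j)] at this
    linarith
  · rcases hmem t ht with (hz | hz) | hz
    · exact notMem_cantorE_of_mem_segment hqi.symm hx hz
    · exact notMem_cantorE_of_mem_segment (hqj.trans hrj.symm) (hqj ▸ hh) hz
    · rcases hy with hy | hy
      · exact notMem_cantorE_of_mem_segment hri (hri ▸ hy) hz
      · exact notMem_cantorE_of_mem_segment (hrj.trans hy) (hrj ▸ hh) hz

theorem exists_apply_notMem_cantorF {z : E2} (hz : z ∉ cantorE) : ∃ i, z i ∉ cantorF := by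
  by_contra! h
  exact hz ⟨h 0, h 1⟩

/-- there is `C > 0` such that any two points of `[0,1]² \ E` are joined by a
rectifiable curve of Euclidean length at most `C |x − y|` whose image avoids `E`. -/
theorem stmt10 :
    ∃ C : ℝ, 0 < C ∧
      ∀ x ∈ unitSq \ cantorE, ∀ y ∈ unitSq \ cantorE,
        ∃ γ : ℝ → E2, ContinuousOn γ (Set.Icc 0 1) ∧ γ 0 = x ∧ γ 1 = y ∧
          eVariationOn γ (Set.Icc 0 1) ≤ ENNReal.ofReal (C * dist x y) ∧
          ∀ t ∈ Set.Icc (0 : ℝ) 1, γ t ∉ cantorE := by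
  refine ⟨12, by norm_num, fun x ⟨_, hx⟩ y ⟨_, hy⟩ => ?_⟩
  rcases eq_or_ne x y with rfl | hxy
  · exact ⟨fun _ => x, continuousOn_const, rfl, rfl,
      by simp [eVariationOn.constant_on (Set.subsingleton_singleton.anti
        (Set.image_subset_iff.2 fun _ _ => Set.mem_singleton x))], fun _ _ => hx⟩
  obtain ⟨i, hi⟩ := exists_apply_notMem_cantorF hx
  obtain ⟨k, hk⟩ := exists_apply_notMem_cantorF hy
  obtain ⟨j, hj⟩ := exists_ne i
  rcases eq_or_ne k i with rfl | hki
  · obtain ⟨h, hh, hd⟩ := exists_notMem_cantorF_abs_sub_le (x j) (dist_pos.2 hxy)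
    exact exists_curve_along_line hj.symm hi hh (Or.inl hk) hd
  · exact exists_curve_along_line hki.symm hi hk (Or.inr rfl) (abs_apply_sub_le_dist x y k)

end
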